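/- arXiv:1706.01109 — 2 statements merged into one kernel-verified Lean document; each statement's English description precedes it below -/
import Mathlib

section
/- Let n be a natural number, let T : ℝⁿ → ℝⁿ be a continuous map, and suppose there is a constant C such that ‖T(z)‖ ≤ C for all z ∈ ℝⁿ. Then for every real number c the equation z = c · T(z) has a solution, i.e., there exists z* ∈ ℝⁿ with z* = c • T(z*). -/
open MeasureTheory Metric Set Module

section Determinant

variable {E : Type*} [NormedAddCommGroup E] [NormedSpace ℝ E] [FiniteDimensional ℝ E]

/-- `det (1 + t A)` is a polynomial in `t` of degree at most the dimension. -/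
lemma exists_polynomial_det_one_add_smul (A : E →L[ℝ] E) :
    ∃ p : Polynomial ℝ, p.natDegree ≤ finrank ℝ E ∧
      ∀ t : ℝ, p.eval t = (1 + t • A).det := by
  let b := finBasis ℝ E
  let M := LinearMap.toMatrix b b (A : E →ₗ[ℝ] E)
  refine ⟨Matrix.det ((Polynomial.X : Polynomial ℝ) • M.map Polynomial.C +
    (1 : Matrix _ _ ℝ).map Polynomial.C), ?_, fun t => ?_⟩
  · simpa using Polynomial.natDegree_det_X_add_C_le M 1
  · rw [← Polynomial.coe_evalRingHom, RingHom.map_det, ContinuousLinearMap.det,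
      ← LinearMap.det_toMatrix b]
    congr 1
    ext i j
    rcases eq_or_ne i j with rfl | h
    · simp [M, add_comm, mul_comm t]
    · simp [M, Matrix.one_apply_ne h, mul_comm t]

/-- A perturbation of the identity by an operator of norm less than one has positive determinant. -/
lemma det_one_add_smul_pos (A : E →L[ℝ] E) {L t : ℝ} (hA : ‖A‖ ≤ L) (ht : 0 ≤ t)
    (htL : t * L < 1) : 0 < (1 + t • A).det := by
  have hL : 0 ≤ L := (norm_nonneg A).trans hA
  have hne : ∀ s ∈ Icc 0 t, (1 + s • A).det ≠ 0 := by
    intro s hs h0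
    have hlt := LinearMap.bot_lt_ker_of_det_eq_zero h0
    obtain ⟨v, hv, hv0⟩ := (Submodule.ne_bot_iff _).1 hlt.ne'
    have hv' : v + s • A v = 0 := by simpa using hv
    have h1 : ‖v‖ = s * ‖A v‖ := by
      rw [← Real.norm_of_nonneg hs.1, ← norm_smul, ← norm_neg (s • A v),
        ← eq_neg_of_add_eq_zero_left hv']
    have h2 : ‖A v‖ ≤ L * ‖v‖ := A.le_of_opNorm_le hA v
    have h3 : 0 < ‖v‖ := norm_pos_iff.2 hv0
    have h4 : s * ‖A v‖ ≤ t * (L * ‖v‖) := mul_le_mul hs.2 h2 (norm_nonneg _) ht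
    nlinarith
  by_contra! hneg
  have hcont : ContinuousOn (fun s : ℝ => (1 + s • A).det) (Icc 0 t) :=
    (ContinuousLinearMap.continuous_det.comp (by fun_prop)).continuousOn
  have h0 : (1 + (0 : ℝ) • A).det = 1 := by
    simp [ContinuousLinearMap.det]
  obtain ⟨s, hs, hs0⟩ := intermediate_value_Icc' ht hcont
    (show (0 : ℝ) ∈ Icc _ _ from ⟨hneg, by simp only [h0, zero_le_one]⟩)
  exact hne s hs hs0

end Determinant

/-- A family of polynomials of bounded degree whose integral is constant on an interval has
the same integral everywhere. -/
lemma integral_eval_eq_of_eqOn_Ioo {α : Type*} [MeasurableSpace α] {μ : Measure α}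
    {P : α → Polynomial ℝ} {N : ℕ} (hP : ∀ x, (P x).natDegree ≤ N)
    (hint : ∀ t : ℝ, Integrable (fun x => (P x).eval t) μ) {δ V : ℝ} (hδ : 0 < δ)
    (hV : ∀ t ∈ Ioo 0 δ, ∫ x, (P x).eval t ∂μ = V) (t : ℝ) :
    ∫ x, (P x).eval t ∂μ = V := by
  obtain ⟨s, hs, hcard⟩ := (Ioo_infinite hδ).exists_subset_card_eq (N + 1)
  have hinj : Set.InjOn (id : ℝ → ℝ) s := Function.injective_id.injOn
  have hne : s.Nonempty := by rw [← Finset.card_pos]; omega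
  have key : ∀ x, (P x).eval t = ∑ i ∈ s, (P x).eval i * (Lagrange.basis s id i).eval t := by
    intro x
    have hdeg : (P x).degree < s.card := by
      refine (Polynomial.degree_le_natDegree).trans_lt ?_
      rw [hcard]
      exact_mod_cast Nat.lt_succ_of_le (hP x)
    conv_lhs => rw [Lagrange.eq_interpolate hinj hdeg]
    simp [Lagrange.interpolate_apply, Polynomial.eval_finsetSum]
  simp_rw [key]
  rw [integral_finsetSum _ fun i _ => (hint i).mul_const _]
  simp_rw [integral_mul_const]
  rw [Finset.sum_congr rfl fun i hi => by rw [hV i (hs hi)], ← Finset.mul_sum,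
    ← Polynomial.eval_finsetSum, Lagrange.sum_basis hinj hne]
  simp

section Retraction

variable {E : Type*} [NormedAddCommGroup E] [InnerProductSpace ℝ E] [FiniteDimensional ℝ E]

/-- A differentiable map with values in a sphere has singular derivative. -/
lemma det_fderiv_eq_zero_of_norm_eq {G : E → E} (hG : Differentiable ℝ G) {R : ℝ} (hR : 0 < R)
    (hGR : ∀ x, ‖G x‖ = R) (x : E) : (fderiv ℝ G x).det = 0 := by
  by_contra hdet
  obtain ⟨v, hv⟩ : ∃ v, fderiv ℝ G x v = G x :=
    ⟨((fderiv ℝ G x).toContinuousLinearEquivOfDetNeZero hdet).symm (G x), by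
      rw [← ContinuousLinearMap.toContinuousLinearEquivOfDetNeZero_apply _ hdet,
        ContinuousLinearEquiv.apply_symm_apply]⟩
  have h1 := (hG x).hasFDerivAt.norm_sq
  have h2 : HasFDerivAt (fun y => ‖G y‖ ^ 2) (0 : E →L[ℝ] ℝ) x := by
    simp_rw [hGR]
    exact hasFDerivAt_const _ _
  have h3 := DFunLike.congr_fun (h1.unique h2) v
  simp [hv, hGR, hR.ne'] at h3

/-- A `C¹` map that fixes a sphere pointwise, maps the open ball into itself and is nonsingular there
maps the open ball onto itself. -/
lemma image_ball_eq_ball {F : E → E} (hF : ContDiff ℝ 1 F) {R : ℝ}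
    (hsphere : ∀ x, ‖x‖ = R → F x = x) (hmaps : MapsTo F (ball 0 R) (ball 0 R))
    (hdet : ∀ x ∈ ball (0 : E) R, (fderiv ℝ F x).det ≠ 0) :
    F '' ball 0 R = ball 0 R := by
  rcases le_or_gt R 0 with hR | hR
  · simp [ball_eq_empty.2 hR]
  refine Subset.antisymm hmaps.image_subset ?_
  refine (convex_ball (0 : E) R).isPreconnected.subset_of_closure_inter_subset ?_ ?_ ?_
  · rw [isOpen_iff_mem_nhds]
    rintro _ ⟨x, hx, rfl⟩
    have h1 : HasStrictFDerivAt F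
        (((fderiv ℝ F x).toContinuousLinearEquivOfDetNeZero (hdet x hx) : E ≃L[ℝ] E) :
          E →L[ℝ] E) x := by
      rw [ContinuousLinearMap.coe_toContinuousLinearEquivOfDetNeZero]
      exact hF.contDiffAt.hasStrictFDerivAt one_ne_zero
    rw [← h1.map_nhds_eq_of_equiv]
    exact Filter.image_mem_map (isOpen_ball.mem_nhds hx)
  · have h0 : (0 : E) ∈ ball (0 : E) R := mem_ball_self hR
    exact ⟨F 0, hmaps h0, 0, h0, rfl⟩
  · rintro y ⟨hy, hyR⟩
    have hclosed : IsClosed (F '' closedBall 0 R) :=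
      ((isCompact_closedBall 0 R).image hF.continuous).isClosed
    obtain ⟨x, hx, rfl⟩ := closure_minimal (image_mono ball_subset_closedBall) hclosed hy
    rcases (mem_closedBall_zero_iff.1 hx).lt_or_eq with h | h
    · exact ⟨x, mem_ball_zero_iff.2 h, rfl⟩
    · rw [hsphere x h, mem_ball_zero_iff] at hyR
      exact absurd h hyR.ne

/-- There is no `C¹` retraction of a ball onto its boundary sphere. -/
theorem not_contDiff_retraction_sphere {G : E → E} (hG : ContDiff ℝ 1 G) {R : ℝ} (hR : 0 < R)
    (hsphere : ∀ x, ‖x‖ = R → G x = x) (hGR : ∀ x, ‖G x‖ = R) : False := by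
  borelize E
  let μ : Measure E := volume
  let g : E → E := fun x => G x - x
  have hg : ContDiff ℝ 1 g := hG.sub contDiff_id
  have hgd : Differentiable ℝ g := hg.differentiable one_ne_zero
  have hg' : Continuous (fderiv ℝ g) := hg.continuous_fderiv one_ne_zero
  obtain ⟨L, hL⟩ := (isCompact_closedBall (0 : E) R).exists_bound_of_continuousOn hg'.continuousOn
  have hL0 : 0 ≤ L :=
    (norm_nonneg _).trans (hL 0 (mem_closedBall_self hR.le))
  choose P hPdeg hPeval using fun x => exists_polynomial_det_one_add_smul (fderiv ℝ g x)
  have hcont : ∀ t : ℝ, Continuous fun x => (P x).eval t := by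
    intro t
    simp_rw [hPeval]
    exact ContinuousLinearMap.continuous_det.comp (by fun_prop)
  have hint : ∀ t : ℝ, Integrable (fun x => (P x).eval t) (μ.restrict (ball 0 R)) := fun t =>
    ((hcont t).continuousOn.integrableOn_compact (isCompact_closedBall 0 R)).mono_set
      ball_subset_closedBall
  have hFderiv : ∀ (t : ℝ) (x : E), HasFDerivAt (fun x => x + t • g x) (1 + t • fderiv ℝ g x) x :=
    fun t x => (hasFDerivAt_id x).add ((hgd x).hasFDerivAt.const_smul t)
  have hsmall : ∀ t ∈ Ioo 0 (1 / (L + 1)),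
      ∫ x in ball 0 R, (P x).eval t ∂μ = μ.real (ball 0 R) := by
    rintro t ⟨ht0, ht⟩
    rw [lt_div_iff₀ (by linarith)] at ht
    have htL : t * L < 1 := by linarith
    have ht1 : t < 1 := by nlinarith
    have hpos : ∀ x ∈ ball (0 : E) R, 0 < (1 + t • fderiv ℝ g x).det := fun x hx =>
      det_one_add_smul_pos _ (hL x (ball_subset_closedBall hx)) ht0.le htL
    have hinj : InjOn (fun x => x + t • g x) (ball 0 R) := by
      intro x hx y hy hxy
      have h1 : ‖g y - g x‖ ≤ L * ‖y - x‖ :=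
        (convex_ball (0 : E) R).norm_image_sub_le_of_norm_fderiv_le (fun z _ => hgd z)
          (fun z hz => hL z (ball_subset_closedBall hz)) hx hy
      have h2 : y - x = -(t • (g y - g x)) := by
        have h4 : x + t • g x = y + t • g y := hxy
        rw [smul_sub, neg_sub, sub_eq_sub_iff_add_eq_add, ← h4, add_comm]
      have h3 : ‖y - x‖ = t * ‖g y - g x‖ := by
        conv_lhs => rw [h2]
        rw [norm_neg, norm_smul, Real.norm_of_nonneg ht0.le]
      by_contra hne
      have h5 : 0 < ‖y - x‖ := norm_pos_iff.2 (sub_ne_zero.2 (Ne.symm hne))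
      nlinarith
    have hF : ContDiff ℝ 1 fun x => x + t • g x := contDiff_id.add (contDiff_const.smul hg)
    have himage : (fun x => x + t • g x) '' ball 0 R = ball 0 R := by
      refine image_ball_eq_ball hF ?_ ?_ ?_
      · intro x hx
        simp [g, hsphere x hx]
      · intro x hx
        rw [mem_ball_zero_iff] at hx ⊢
        have h1 : x + t • g x = (1 - t) • x + t • G x := by
          simp only [g]
          module
        simp only [h1]
        refine (norm_add_le _ _).trans_lt ?_
        rw [norm_smul, norm_smul, hGR, Real.norm_of_nonneg ht0.le,
          Real.norm_of_nonneg (by linarith : 0 ≤ 1 - t)]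
        nlinarith
      · intro x hx
        rw [(hFderiv t x).fderiv]
        exact (hpos x hx).ne'
    have hchange := integral_image_eq_integral_abs_det_fderiv_smul μ measurableSet_ball
      (fun x _ => (hFderiv t x).hasFDerivWithinAt) hinj (fun _ => (1 : ℝ))
    rw [himage] at hchange
    rw [setIntegral_const, smul_eq_mul, mul_one] at hchange
    rw [hchange]
    refine setIntegral_congr_fun measurableSet_ball fun x hx => ?_
    simp [hPeval, abs_of_pos (hpos x hx)]
  have hone := integral_eval_eq_of_eqOn_Ioo hPdeg hint (by positivity) hsmall 1
  have hzero : ∀ x, (P x).eval 1 = 0 := by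
    intro x
    have h1 : (1 : E →L[ℝ] E) + (1 : ℝ) • fderiv ℝ g x = fderiv ℝ G x := by
      rw [← (hFderiv 1 x).fderiv]
      simp [g]
    rw [hPeval, h1]
    exact det_fderiv_eq_zero_of_norm_eq (hG.differentiable one_ne_zero) hR hGR x
  simp only [hzero, integral_zero] at hone
  exact (ENNReal.toReal_pos (measure_ball_pos μ 0 hR).ne' measure_ball_lt_top.ne).ne hone

/-- A continuous map vanishing outside a ball has a fixed point. -/
theorem exists_fixedPoint_of_eq_zero_of_le_norm {f : E → E} (hf : Continuous f) {R : ℝ}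
    (hR : 0 < R) (hfR : ∀ x, R ≤ ‖x‖ → f x = 0) : ∃ x, f x = x := by
  by_contra! hne
  obtain ⟨x₀, -, hx₀⟩ := (isCompact_closedBall (0 : E) R).exists_isMinOn
    ⟨0, mem_closedBall_self hR.le⟩
    (show ContinuousOn (fun x => dist (f x) x) (closedBall 0 R) by fun_prop)
  obtain ⟨g, hg, hgf, hsupp⟩ := hf.exists_contDiff_approx 1
    (continuous_const (y := dist (f x₀) x₀)) fun _ => dist_pos.2 (hne x₀)
  have hgR : ∀ x, R ≤ ‖x‖ → g x = 0 := fun x hx => by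
    by_contra h
    exact hsupp h (hfR x hx)
  have hH0 : ∀ x, x - g x ≠ 0 := by
    intro x hx
    rcases le_total ‖x‖ R with h | h
    · have h1 : dist (f x₀) x₀ ≤ dist (f x) x := hx₀ (mem_closedBall_zero_iff.2 h)
      have h2 := hgf x
      rw [← sub_eq_zero.1 hx, dist_comm] at h2
      exact h1.not_gt h2
    · rw [hgR x h, sub_zero] at hx
      rw [hx, norm_zero] at h
      exact h.not_gt hR
  have hH : ContDiff ℝ 1 fun x => x - g x := contDiff_id.sub hg
  refine not_contDiff_retraction_sphere (G := fun x => (R / ‖x - g x‖) • (x - g x))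
    ((contDiff_const.div (hH.norm ℝ hH0) fun x => norm_ne_zero_iff.2 (hH0 x)).smul hH) hR ?_ ?_
  · intro x hx
    simp [hgR x hx.ge, hx, hR.ne']
  · intro x
    rw [norm_smul, norm_div, norm_norm, Real.norm_of_nonneg hR.le,
      div_mul_cancel₀ _ (norm_ne_zero_iff.2 (hH0 x))]

/-- A bounded continuous self-map of a finite-dimensional space has a fixed point. -/
theorem exists_fixedPoint_of_norm_le {f : E → E} (hf : Continuous f) {K : ℝ}
    (hK : ∀ x, ‖f x‖ ≤ K) : ∃ x, f x = x := by
  have hK0 : 0 ≤ K := (norm_nonneg _).trans (hK 0)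
  let χ : E → ℝ := fun x => max 0 (min 1 (K + 1 - ‖x‖))
  have hχ : Continuous χ := by fun_prop
  obtain ⟨x, hx⟩ := exists_fixedPoint_of_eq_zero_of_le_norm (hχ.smul hf)
    (show 0 < K + 1 by linarith) fun x hx => by
      have : χ x = 0 := max_eq_left ((min_le_right _ _).trans (by linarith))
      simp [this]
  have hx' : χ x • f x = x := hx
  have hχ0 : 0 ≤ χ x := le_max_left _ _
  have hχ1 : χ x ≤ 1 := max_le zero_le_one (min_le_left _ _)
  have hxK : ‖x‖ ≤ K := by
    rw [← hx', norm_smul, Real.norm_of_nonneg hχ0]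
    exact (mul_le_of_le_one_left (norm_nonneg _) hχ1).trans (hK x)
  have hχx : χ x = 1 := by
    simp only [χ]
    rw [min_eq_left (by linarith), max_eq_right zero_le_one]
  exact ⟨x, by rwa [hχx, one_smul] at hx'⟩

end Retraction

/-- Theorem 1 of the paper: the stationary equation `z = c • T z` has a solution
whenever `T : ℝⁿ → ℝⁿ` is continuous and bounded. -/
theorem stationary_equation_has_solution
    (n : ℕ) (T : EuclideanSpace ℝ (Fin n) → EuclideanSpace ℝ (Fin n))
    (hT_cont : Continuous T) (C : ℝ) (hT_bdd : ∀ z, ‖T z‖ ≤ C) (c : ℝ) :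
    ∃ zstar : EuclideanSpace ℝ (Fin n), zstar = c • T zstar := by
  obtain ⟨z, hz⟩ := exists_fixedPoint_of_norm_le (hT_cont.const_smul c) (K := |c| * C) fun z => by
    rw [Pi.smul_apply, norm_smul, Real.norm_eq_abs]
    exact mul_le_mul_of_nonneg_left (hT_bdd z) (abs_nonneg c)
  exact ⟨z, hz.symm⟩
end

section
/- Let n be a natural number, T : ℝⁿ → ℝⁿ a map, c a real number, and 0 ≤ q < 1 such that ‖c • T(z) − c • T(w)‖ ≤ q·‖z − w‖ for all z, w ∈ ℝⁿ (i.e., c·T is a q-contraction), and let z* be its (unique) fixed point, z* = c • T(z*). Let (η_m) be a sequence with 0 < η_m ≤ 1 for all m and ∑_m η_m = ∞, and define a sequence (z_m) in ℝⁿ by an arbitrary initial point z_1 and the recursion z_{m+1} = (1 − η_m) • z_m + η_m • (c • T(z_m)). Then z_m converges to z* as m → ∞. -/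
/-- A nonnegative sequence contracted at step `m` by a factor `1 - t m` tends to zero when the
partial sums of `t` diverge. -/
lemma tendsto_zero_of_le_one_sub_mul {a t : ℕ → ℝ} (ha : ∀ m, 0 ≤ a m)
    (hstep : ∀ m, a (m + 1) ≤ (1 - t m) * a m)
    (hdiv : Filter.Tendsto (fun N => ∑ m ∈ Finset.range N, t m) Filter.atTop Filter.atTop) :
    Filter.Tendsto a Filter.atTop (nhds 0) := by
  have hbound (N : ℕ) : a N ≤ Real.exp (-∑ m ∈ Finset.range N, t m) * a 0 := by
    induction N with
    | zero => simp
    | succ N ih =>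
      calc a (N + 1) ≤ (1 - t N) * a N := hstep N
        _ ≤ Real.exp (-t N) * a N :=
          mul_le_mul_of_nonneg_right (Real.one_sub_le_exp_neg _) (ha N)
        _ ≤ Real.exp (-t N) * (Real.exp (-∑ m ∈ Finset.range N, t m) * a 0) :=
          mul_le_mul_of_nonneg_left ih (Real.exp_pos _).le
        _ = Real.exp (-∑ m ∈ Finset.range (N + 1), t m) * a 0 := by
          rw [Finset.sum_range_succ, neg_add, Real.exp_add]
          ring
  have hlim : Filter.Tendsto (fun N => Real.exp (-∑ m ∈ Finset.range N, t m) * a 0)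
      Filter.atTop (nhds 0) := by
    simpa using (Real.tendsto_exp_neg_atTop_nhds_zero.comp hdiv).mul_const (a 0)
  exact squeeze_zero ha hbound hlim

/-- Deterministic form of Theorem 2: the InfiniteBoost iteration
`z_{m+1} = (1 - η_m) • z_m + η_m • (c • T z_m)` converges to the fixed point of the
contraction `c • T` when `0 < η_m ≤ 1` and `∑ η_m = ∞`. -/
theorem infiniteboost_deterministic_convergence
    (n : ℕ) (T : EuclideanSpace ℝ (Fin n) → EuclideanSpace ℝ (Fin n))
    (c : ℝ) (q : ℝ) (hq0 : 0 ≤ q) (hq1 : q < 1)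
    (hcontraction : ∀ z w, ‖c • T z - c • T w‖ ≤ q * ‖z - w‖)
    (zstar : EuclideanSpace ℝ (Fin n)) (hfix : zstar = c • T zstar)
    (η : ℕ → ℝ) (hη_pos : ∀ m, 0 < η m) (hη_le : ∀ m, η m ≤ 1)
    (hη_div : Filter.Tendsto (fun N => ∑ m ∈ Finset.range N, η m)
      Filter.atTop Filter.atTop)
    (z : ℕ → EuclideanSpace ℝ (Fin n))
    (hrec : ∀ m, z (m + 1) = (1 - η m) • z m + η m • (c • T (z m))) :
    Filter.Tendsto z Filter.atTop (nhds zstar) := by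
  rw [tendsto_iff_norm_sub_tendsto_zero]
  refine tendsto_zero_of_le_one_sub_mul (t := fun m => (1 - q) * η m)
    (fun m => norm_nonneg _) (fun m => ?_) ?_
  · have hsplit : z (m + 1) - zstar =
        (1 - η m) • (z m - zstar) + η m • (c • T (z m) - c • T zstar) := by
      rw [hrec, ← hfix]
      module
    calc ‖z (m + 1) - zstar‖
        ≤ ‖(1 - η m) • (z m - zstar)‖ + ‖η m • (c • T (z m) - c • T zstar)‖ := by
          rw [hsplit]
          exact norm_add_le _ _
      _ = (1 - η m) * ‖z m - zstar‖ + η m * ‖c • T (z m) - c • T zstar‖ := by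
          rw [norm_smul, norm_smul, Real.norm_of_nonneg (sub_nonneg.2 (hη_le m)),
            Real.norm_of_nonneg (hη_pos m).le]
      _ ≤ (1 - η m) * ‖z m - zstar‖ + η m * (q * ‖z m - zstar‖) := by
          gcongr
          · exact (hη_pos m).le
          · exact hcontraction _ _
      _ = (1 - (1 - q) * η m) * ‖z m - zstar‖ := by ring
  · simpa only [Finset.mul_sum] using hη_div.const_mul_atTop (sub_pos.2 hq1)
end
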